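/- arXiv:1702.00277 — 2 statements merged into one kernel-verified Lean document; each statement's English description precedes it below -/
import Mathlib

section
/- Let E be the attractor of an IFS of contracting similarities f₁,…,f_k on ℝ^d with ratios λ_i, satisfying the open set condition, and let s satisfy ∑ λ_i^s = 1. Then ℋ^s(E) > 0, and consequently dim_H(E) = dim_M(E) = s. -/
open ENNReal MeasureTheory

open Filter

/-- Least number (in `ℝ≥0∞`) of closed `δ`-balls needed to cover `A`. -/
noncomputable def coverNum {d : ℕ} (A : Set (EuclideanSpace ℝ (Fin d))) (δ : ℝ) : ℝ≥0∞ :=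
  ⨅ (t : Finset (EuclideanSpace ℝ (Fin d)))
    (_ : A ⊆ ⋃ x ∈ t, Metric.closedBall x δ), (t.card : ℝ≥0∞)

/-- The upper Minkowski (box-counting) dimension of `A`. -/
noncomputable def uMinkDim {d : ℕ} (A : Set (EuclideanSpace ℝ (Fin d))) : ℝ :=
  sInf {s : ℝ | 0 ≤ s ∧
    Filter.limsup (fun δ : ℝ => coverNum A δ * ENNReal.ofReal (δ ^ s)) (nhdsWithin 0 (Set.Ioi 0)) < ⊤}

namespace IteratedFunctionSystem

section Words

variable {ι X : Type*}

/-- The composition `f i₁ ∘ ⋯ ∘ f iₙ` along the word `[i₁, …, iₙ]`. -/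
def wordMap (f : ι → X → X) : List ι → X → X
  | [] => id
  | i :: p => f i ∘ wordMap f p

/-- The contraction ratio of `wordMap f p` for maps with ratios `lam`. -/
def wordRatio (lam : ι → ℝ) (p : List ι) : ℝ := (p.map lam).prod

/-- `IsCut lam r p` says that, for `r < 1`, the ratio of `p` is at most `r` while the ratio of
each proper prefix of `p` exceeds `r`. -/
def IsCut (lam : ι → ℝ) : ℝ → List ι → Prop
  | r, [] => 1 ≤ r
  | r, i :: p => r < 1 ∧ IsCut lam (r / lam i) p

/-- The set of infinite words starting with `p`. -/
def cylinderSet (p : List ι) : Set (ℕ → ι) :=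
  Set.pi (Finset.range p.length) fun j => {x | p[j]? = some x}

theorem mem_cylinderSet_nil (w : ℕ → ι) : w ∈ cylinderSet ([] : List ι) := by
  simp [cylinderSet]

theorem mem_cylinderSet_cons {i : ι} {p : List ι} {w : ℕ → ι} :
    w ∈ cylinderSet (i :: p) ↔ w 0 = i ∧ (fun n => w (n + 1)) ∈ cylinderSet p := by
  simp only [cylinderSet, Set.mem_pi, Finset.coe_range, Set.mem_Iio, Set.mem_ofPred_eq,
    List.length_cons]
  constructor
  · intro h
    refine ⟨?_, fun j hj => ?_⟩
    · have := h 0 (by omega)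
      simp at this
      exact this.symm
    · simpa using h (j + 1) (by omega)
  · rintro ⟨h0, h⟩ j hj
    cases j with
    | zero => simp [h0]
    | succ j => simpa using h j (by omega)

variable {lam : ι → ℝ}

theorem wordRatio_pos (h : ∀ i, 0 < lam i) (p : List ι) : 0 < wordRatio lam p := by
  induction p with
  | nil => simp [wordRatio]
  | cons i p ih => simpa [wordRatio] using mul_pos (h i) ih

theorem wordRatio_rpow (h : ∀ i, 0 < lam i) (s : ℝ) (p : List ι) :
    wordRatio (fun i => lam i ^ s) p = wordRatio lam p ^ s := by
  induction p with
  | nil => simp [wordRatio]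
  | cons i p ih =>
    have := wordRatio_pos h p
    simp only [wordRatio, List.map_cons, List.prod_cons] at ih this ⊢
    rw [ih, Real.mul_rpow (h i).le this.le]

theorem IsCut.wordRatio_le (h : ∀ i, 0 < lam i) {p : List ι} :
    ∀ {r : ℝ}, IsCut lam r p → wordRatio lam p ≤ r := by
  induction p with
  | nil => intro r hr; simpa [wordRatio, IsCut] using hr
  | cons i p ih =>
    intro r hr
    have := (le_div_iff₀ (h i)).1 (ih hr.2)
    simp only [wordRatio, List.map_cons, List.prod_cons] at this ⊢
    linarith

theorem IsCut.le_wordRatio (h : ∀ i, 0 < lam i) {l : ℝ} (hl : ∀ i, l ≤ lam i)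
    {p : List ι} : ∀ {r : ℝ}, 0 < r → l * r ≤ 1 → IsCut lam r p → l * r ≤ wordRatio lam p := by
  induction p with
  | nil => intro r _ h1 _; simpa [wordRatio] using h1
  | cons i p ih =>
    intro r hr0 h1 hr
    have h2 : l * (r / lam i) ≤ 1 := by
      rw [← mul_div_assoc, div_le_one (h i)]
      have := mul_le_mul_of_nonneg_right (hl i) hr0.le
      have := mul_le_mul_of_nonneg_left hr.1.le (h i).le
      linarith
    have := ih (div_pos hr0 (h i)) h2 hr.2
    rw [← mul_div_assoc, div_le_iff₀ (h i)] at this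
    simp only [wordRatio, List.map_cons, List.prod_cons] at this ⊢
    linarith

theorem IsCut.eq_of_mem_cylinderSet {p : List ι} :
    ∀ {q : List ι} {r : ℝ} {w : ℕ → ι}, IsCut lam r p → IsCut lam r q →
      w ∈ cylinderSet p → w ∈ cylinderSet q → p = q := by
  induction p with
  | nil =>
    rintro (_ | ⟨j, q⟩) r w hp hq _ _
    · rfl
    · exact absurd hq.1 (not_lt.2 hp)
  | cons i p ih =>
    rintro (_ | ⟨j, q⟩) r w hp hq hwp hwq
    · exact absurd hp.1 (not_lt.2 hq)
    · rw [mem_cylinderSet_cons] at hwp hwq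
      obtain rfl : i = j := hwp.1.symm.trans hwq.1
      rw [ih hp.2 hq.2 hwp.2 hwq.2]

theorem exists_isCut_mem_cylinderSet (h : ∀ i, 0 < lam i) {L : ℝ} (hL : ∀ i, lam i ≤ L)
    (hL0 : 0 ≤ L) (N : ℕ) :
    ∀ (r : ℝ) (w : ℕ → ι), L ^ N ≤ r → ∃ p, IsCut lam r p ∧ w ∈ cylinderSet p := by
  induction N with
  | zero => exact fun r w hr => ⟨[], by simpa [IsCut] using hr, mem_cylinderSet_nil w⟩
  | succ N ih =>
    intro r w hr
    by_cases h1 : 1 ≤ r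
    · exact ⟨[], h1, mem_cylinderSet_nil w⟩
    · obtain ⟨p, hp, hw⟩ := ih (r / lam (w 0)) (fun n => w (n + 1)) (by
        rw [le_div_iff₀ (h _)]
        exact (mul_le_mul_of_nonneg_left (hL _) (pow_nonneg hL0 N)).trans hr)
      exact ⟨w 0 :: p, ⟨not_le.1 h1, hp⟩, mem_cylinderSet_cons.2 ⟨rfl, hw⟩⟩

theorem finite_setOf_isCut [Finite ι] (h : ∀ i, 0 < lam i) {L : ℝ} (hL : ∀ i, lam i ≤ L)
    (hL0 : 0 ≤ L) (N : ℕ) : ∀ r : ℝ, L ^ N ≤ r → {p | IsCut lam r p}.Finite := by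
  induction N with
  | zero =>
    intro r hr
    refine (Set.finite_singleton []).subset ?_
    rintro (_ | ⟨i, p⟩) hp
    · rfl
    · exact absurd hp.1 (not_lt.2 (by simpa using hr))
  | succ N ih =>
    intro r hr
    refine ((Set.finite_singleton []).union (Set.finite_iUnion fun i =>
      (ih (r / lam i) ?_).image (List.cons i))).subset ?_
    · rw [le_div_iff₀ (h _)]
      exact (mul_le_mul_of_nonneg_left (hL _) (pow_nonneg hL0 N)).trans hr
    · rintro (_ | ⟨i, p⟩) hp
      · exact Or.inl rfl
      · exact Or.inr (Set.mem_iUnion.2 ⟨i, p, hp.2, rfl⟩)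

variable {f : ι → X → X}

theorem wordMap_image_subset {V : Set X} (hV : ∀ i, f i '' V ⊆ V) (p : List ι) :
    wordMap f p '' V ⊆ V := by
  induction p with
  | nil => simp [wordMap]
  | cons i p ih =>
    rw [wordMap, Set.image_comp]
    exact (Set.image_mono ih).trans (hV i)

theorem wordMap_surjective (hf : ∀ i, Function.Surjective (f i)) (p : List ι) :
    Function.Surjective (wordMap f p) := by
  induction p with
  | nil => exact Function.surjective_id
  | cons i p ih => exact (hf i).comp ih

theorem IsCut.disjoint_image {V : Set X} (hinj : ∀ i, Function.Injective (f i))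
    (hV : ∀ i, f i '' V ⊆ V) (hd : ∀ i j, i ≠ j → Disjoint (f i '' V) (f j '' V)) {p : List ι} :
    ∀ {q : List ι} {r : ℝ}, IsCut lam r p → IsCut lam r q → p ≠ q →
      Disjoint (wordMap f p '' V) (wordMap f q '' V) := by
  induction p with
  | nil =>
    rintro (_ | ⟨j, q⟩) r hp hq hne
    · exact absurd rfl hne
    · exact absurd hq.1 (not_lt.2 hp)
  | cons i p ih =>
    rintro (_ | ⟨j, q⟩) r hp hq hne
    · exact absurd hp.1 (not_lt.2 hq)
    · simp only [wordMap, Set.image_comp]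
      by_cases hij : i = j
      · subst hij
        exact (Set.disjoint_image_iff (hinj i)).2 (ih hp.2 hq.2 fun h => hne (by rw [h]))
      · exact (hd i j hij).mono (Set.image_mono (wordMap_image_subset hV p))
          (Set.image_mono (wordMap_image_subset hV q))

theorem dist_wordMap [PseudoMetricSpace X] (hf : ∀ i x y, dist (f i x) (f i y) = lam i * dist x y)
    (p : List ι) (x y : X) :
    dist (wordMap f p x) (wordMap f p y) = wordRatio lam p * dist x y := by
  induction p with
  | nil => simp [wordMap, wordRatio]
  | cons i p ih =>
    simp only [wordMap, Function.comp_apply, hf, ih, wordRatio, List.map_cons, List.prod_cons]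
    ring

theorem exists_isCut_mem_image (h : ∀ i, 0 < lam i) {L : ℝ} (hL : ∀ i, lam i ≤ L)
    (hL0 : 0 ≤ L) {E : Set X} (hE : E ⊆ ⋃ i, f i '' E) (N : ℕ) :
    ∀ (r : ℝ), L ^ N ≤ r → ∀ x ∈ E, ∃ p, IsCut lam r p ∧ x ∈ wordMap f p '' E := by
  induction N with
  | zero => exact fun r hr x hx => ⟨[], by simpa [IsCut] using hr, by simpa [wordMap] using hx⟩
  | succ N ih =>
    intro r hr x hx
    by_cases h1 : 1 ≤ r
    · exact ⟨[], h1, by simpa [wordMap] using hx⟩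
    · obtain ⟨i, y, hy, rfl⟩ := Set.mem_iUnion.1 (hE hx)
      obtain ⟨p, hp, hyp⟩ := ih (r / lam i) (by
        rw [le_div_iff₀ (h _)]
        exact (mul_le_mul_of_nonneg_left (hL _) (pow_nonneg hL0 N)).trans hr) y hy
      refine ⟨i :: p, ⟨not_le.1 h1, hp⟩, ?_⟩
      rw [wordMap, Set.image_comp]
      exact Set.mem_image_of_mem _ hyp

/-- The image of `E` under the first `n` maps prescribed by the infinite word `w`. -/
def prefixImage (f : ι → X → X) (E : Set X) : ℕ → (ℕ → ι) → Set X
  | 0, _ => E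
  | n + 1, w => f (w 0) '' prefixImage f E n fun m => w (m + 1)

theorem prefixImage_length {E : Set X} {p : List ι} :
    ∀ {w : ℕ → ι}, w ∈ cylinderSet p → prefixImage f E p.length w = wordMap f p '' E := by
  induction p with
  | nil => intro w _; simp [prefixImage, wordMap]
  | cons i p ih =>
    intro w hw
    rw [mem_cylinderSet_cons] at hw
    rw [List.length_cons, prefixImage, ih hw.2, hw.1, wordMap, Set.image_comp]

theorem prefixImage_succ_subset {E : Set X} (hE : ∀ i, f i '' E ⊆ E) (n : ℕ) :
    ∀ w : ℕ → ι, prefixImage f E (n + 1) w ⊆ prefixImage f E n w := by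
  induction n with
  | zero => exact fun w => hE _
  | succ n ih => exact fun w => Set.image_mono (ih _)

theorem exists_forall_mem_wordMap_image [TopologicalSpace X] [T2Space X] (hf : ∀ i, Continuous (f i))
    {E : Set X} (hne : E.Nonempty) (hc : IsCompact E) (hE : ∀ i, f i '' E ⊆ E) (w : ℕ → ι) :
    ∃ x, ∀ p, w ∈ cylinderSet p → x ∈ wordMap f p '' E := by
  have key : ∀ n, ∀ w : ℕ → ι, (prefixImage f E n w).Nonempty ∧ IsCompact (prefixImage f E n w) := by
    intro n
    induction n with
    | zero => exact fun w => ⟨hne, hc⟩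
    | succ n ih => exact fun w => ⟨(ih _).1.image _, (ih _).2.image (hf _)⟩
  obtain ⟨x, hx⟩ := IsCompact.nonempty_iInter_of_sequence_nonempty_isCompact_isClosed
    (fun n => prefixImage f E n w) (fun n => prefixImage_succ_subset hE n w)
    (fun n => (key n w).1) (key 0 w).2 (fun n => (key n w).2.isClosed)
  exact ⟨x, fun p hp => prefixImage_length hp ▸ Set.mem_iInter.1 hx p.length⟩

end Words

section Bernoulli

variable {ι : Type*} [Fintype ι] [MeasurableSpace ι]

/-- The law of a random letter with weights `a`. -/
noncomputable def letterMeasure (a : ι → ℝ) : Measure ι :=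
  ∑ i, ENNReal.ofReal (a i) • Measure.dirac i

theorem isProbabilityMeasure_letterMeasure {a : ι → ℝ} (h0 : ∀ i, 0 ≤ a i) (h1 : ∑ i, a i = 1) :
    IsProbabilityMeasure (letterMeasure a) := by
  refine ⟨?_⟩
  simp [letterMeasure, Measure.finsetSum_apply, ← ENNReal.ofReal_sum_of_nonneg fun i _ => h0 i, h1]

variable [MeasurableSingletonClass ι]

theorem letterMeasure_singleton (a : ι → ℝ) (i : ι) :
    letterMeasure a {i} = ENNReal.ofReal (a i) := by
  classical
  simp [letterMeasure, Measure.finsetSum_apply, Set.indicator_apply]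

/-- The Bernoulli measure on infinite words with letter weights `a`. -/
noncomputable def bernoulliMeasure (a : ι → ℝ) : Measure (ℕ → ι) :=
  Measure.infinitePi fun _ => letterMeasure a

theorem measurableSet_cylinderSet (p : List ι) : MeasurableSet (cylinderSet p) :=
  MeasurableSet.pi (Finset.countable_toSet _) fun _ _ => Set.Finite.measurableSet (Set.toFinite _)

theorem bernoulliMeasure_cylinderSet {a : ι → ℝ} (h0 : ∀ i, 0 ≤ a i) (h1 : ∑ i, a i = 1)
    (p : List ι) : bernoulliMeasure a (cylinderSet p) = ENNReal.ofReal (wordRatio a p) := by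
  have := isProbabilityMeasure_letterMeasure h0 h1
  rw [bernoulliMeasure, cylinderSet, Measure.infinitePi_pi _
    fun _ _ => Set.Finite.measurableSet (Set.toFinite _)]
  induction p with
  | nil => simp [wordRatio]
  | cons i p ih =>
    rw [List.length_cons, Finset.prod_range_succ']
    simp only [List.getElem?_cons_succ, List.getElem?_cons_zero, Option.some.injEq, ih,
      wordRatio, List.map_cons, List.prod_cons, Set.ofPred_eq_eq_singleton',
      letterMeasure_singleton]
    rw [mul_comm, ENNReal.ofReal_mul (h0 i)]

theorem sum_wordRatio_rpow_le_one {lam : ι → ℝ} (h : ∀ i, 0 < lam i) {s : ℝ}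
    (hsum : ∑ i, lam i ^ s = 1) {r : ℝ} {T : Finset (List ι)} (hT : ∀ p ∈ T, IsCut lam r p) :
    ∑ p ∈ T, ENNReal.ofReal (wordRatio lam p ^ s) ≤ 1 := by
  have h0 : ∀ i, 0 ≤ lam i ^ s := fun i => (Real.rpow_pos_of_pos (h i) s).le
  have := isProbabilityMeasure_letterMeasure h0 hsum
  have hP : IsProbabilityMeasure (bernoulliMeasure fun i => lam i ^ s) := by
    unfold bernoulliMeasure; infer_instance
  calc ∑ p ∈ T, ENNReal.ofReal (wordRatio lam p ^ s)
      = ∑ p ∈ T, bernoulliMeasure (fun i => lam i ^ s) (cylinderSet p) := by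
        simp only [bernoulliMeasure_cylinderSet h0 hsum, wordRatio_rpow h]
    _ = bernoulliMeasure (fun i => lam i ^ s) (⋃ p ∈ T, cylinderSet p) := by
        rw [measure_biUnion_finset _ fun p _ => measurableSet_cylinderSet p]
        intro p hp q hq hpq
        exact Set.disjoint_left.2 fun w hwp hwq =>
          hpq ((hT p hp).eq_of_mem_cylinderSet (hT q hq) hwp hwq)
    _ ≤ 1 := prob_le_one

end Bernoulli

section Geometry

theorem surjective_of_dist_eq_mul {X : Type*} [NormedAddCommGroup X] [NormedSpace ℝ X]
    [StrictConvexSpace ℝ X] [FiniteDimensional ℝ X] {g : X → X} {c : ℝ} (hc : 0 < c)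
    (hg : ∀ x y, dist (g x) (g y) = c * dist x y) : Function.Surjective g := by
  have hi : Isometry fun x => c⁻¹ • g x := Isometry.of_dist_eq fun x y => by
    rw [dist_smul₀, hg, Real.norm_of_nonneg (inv_pos.2 hc).le, inv_mul_cancel_left₀ hc.ne']
  have hs : Function.Surjective hi.affineIsometryOfStrictConvexSpace.toAffineMap := by
    rw [← AffineMap.linear_surjective_iff]
    exact LinearMap.injective_iff_surjective.1
      hi.affineIsometryOfStrictConvexSpace.linearIsometry.injective
  intro y
  obtain ⟨x, hx⟩ := hs (c⁻¹ • y)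
  exact ⟨x, smul_right_injective X (inv_pos.2 hc).ne' hx⟩

theorem card_le_of_pairwiseDisjoint_ball {X α : Type*} [NormedAddCommGroup X] [NormedSpace ℝ X]
    [FiniteDimensional ℝ X] {T : Finset α} {g : α → X} {ρ R : ℝ} (hρ : 0 < ρ) (hR : 0 < R)
    {u : X} (hd : (T : Set α).PairwiseDisjoint fun p => Metric.ball (g p) ρ)
    (hsub : ∀ p ∈ T, Metric.ball (g p) ρ ⊆ Metric.ball u R) :
    (T.card : ℝ) ≤ (R / ρ) ^ Module.finrank ℝ X := by
  let _ : MeasurableSpace X := borel X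
  have : BorelSpace X := ⟨rfl⟩
  set μ : Measure X := Measure.addHaar
  have h1 : ∑ p ∈ T, μ (Metric.ball (g p) ρ) ≤ μ (Metric.ball u R) := by
    rw [← measure_biUnion_finset hd fun _ _ => Metric.isOpen_ball.measurableSet]
    exact measure_mono (Set.iUnion₂_subset hsub)
  simp only [Measure.addHaar_ball_of_pos μ _ hρ, Measure.addHaar_ball_of_pos μ _ hR,
    Finset.sum_const, nsmul_eq_mul, ← mul_assoc] at h1
  rw [ENNReal.mul_le_mul_iff_left (Metric.measure_ball_pos μ _ one_pos).ne'
    measure_ball_lt_top.ne, ← ENNReal.ofReal_natCast, ← ENNReal.ofReal_mul (Nat.cast_nonneg _),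
    ENNReal.ofReal_le_ofReal_iff (by positivity)] at h1
  rwa [div_pow, le_div_iff₀ (by positivity)]

theorem hausdorffMeasure_lt_top_of_limsup_coverNum_lt_top {d : ℕ}
    {A : Set (EuclideanSpace ℝ (Fin d))} {t : ℝ} (ht : 0 ≤ t)
    (h : limsup (fun δ : ℝ => coverNum A δ * ENNReal.ofReal (δ ^ t)) (nhdsWithin 0 (Set.Ioi 0)) < ⊤) :
    μH[t] A < ⊤ := by
  obtain ⟨K, hK, hKt⟩ := exists_between h
  have h1 := (eventually_lt_of_limsup_lt hK).and self_mem_nhdsWithin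
  have h2 : ∀ δ : ℝ, ∃ T : Finset (EuclideanSpace ℝ (Fin d)),
      coverNum A δ * ENNReal.ofReal (δ ^ t) < K ∧ δ ∈ Set.Ioi 0 →
      A ⊆ (⋃ x ∈ T, Metric.closedBall x δ) ∧ T.card * ENNReal.ofReal (δ ^ t) < K := by
    intro δ
    by_cases hδ : coverNum A δ * ENNReal.ofReal (δ ^ t) < K ∧ δ ∈ Set.Ioi 0
    · have hp : 0 < δ ^ t := Real.rpow_pos_of_pos hδ.2 t
      have h3 := (ENNReal.lt_div_iff_mul_lt (Or.inl (ENNReal.ofReal_pos.2 hp).ne')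
        (Or.inl ENNReal.ofReal_ne_top)).2 hδ.1
      simp only [coverNum, iInf_lt_iff] at h3
      obtain ⟨T, hT, hlt⟩ := h3
      exact ⟨T, fun _ => ⟨hT, ENNReal.mul_lt_of_lt_div hlt⟩⟩
    · exact ⟨∅, fun h => absurd h hδ⟩
  choose T hT using h2
  have hdiam : ∀ (δ : ℝ) (x : EuclideanSpace ℝ (Fin d)), 0 < δ →
      Metric.ediam (Metric.closedBall x δ) ≤ ENNReal.ofReal (2 * δ) := fun δ x hδ => by
    rw [ENNReal.ofReal_mul zero_le_two, ← Metric.closedEBall_ofReal hδ.le]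
    simpa using Metric.ediam_closedEBall_le
  have hlim : Tendsto (fun δ : ℝ => ENNReal.ofReal (2 * δ)) (nhdsWithin 0 (Set.Ioi 0)) (nhds 0) := by
    have : Continuous fun δ : ℝ => ENNReal.ofReal (2 * δ) :=
      ENNReal.continuous_ofReal.comp (by fun_prop)
    simpa using (this.tendsto 0).mono_left nhdsWithin_le_nhds
  have hle := Measure.hausdorffMeasure_le_liminf_sum t A (ι := fun δ => T δ)
    (fun δ => ENNReal.ofReal (2 * δ)) hlim (fun δ x => Metric.closedBall (x : _) δ)
    (h1.mono fun δ hδ x => hdiam δ x hδ.2)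
    (h1.mono fun δ hδ => by
      refine (hT δ hδ).1.trans (Set.iUnion₂_subset fun x hx => ?_)
      exact Set.subset_iUnion (fun i : T δ => Metric.closedBall (i : EuclideanSpace ℝ (Fin d)) δ)
        ⟨x, hx⟩)
  refine (hle.trans (liminf_le_of_frequently_le' (x := ENNReal.ofReal (2 ^ t) * K)
    (Eventually.frequently ?_))).trans_lt (ENNReal.mul_lt_top ENNReal.ofReal_lt_top hKt)
  filter_upwards [h1] with δ hδ
  have hδ0 : 0 < δ := hδ.2
  calc ∑ x : T δ, Metric.ediam (Metric.closedBall (x : EuclideanSpace ℝ (Fin d)) δ) ^ t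
      ≤ ∑ _x : T δ, ENNReal.ofReal (2 ^ t) * ENNReal.ofReal (δ ^ t) := by
        refine Finset.sum_le_sum fun x _ => ?_
        rw [← ENNReal.ofReal_mul (by positivity), ← Real.mul_rpow zero_le_two hδ0.le,
          ← ENNReal.ofReal_rpow_of_nonneg (by positivity) ht]
        exact ENNReal.rpow_le_rpow (hdiam δ x hδ0) ht
    _ = ENNReal.ofReal (2 ^ t) * ((T δ).card * ENNReal.ofReal (δ ^ t)) := by
        simp only [Finset.sum_const, Finset.card_univ, Fintype.card_coe, nsmul_eq_mul]
        ring
    _ ≤ _ := by gcongr; exact (hT δ hδ).2.le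

end Geometry

section Attractor

variable {ι : Type*} {lam : ι → ℝ}

theorem exists_forall_le_of_pos [Finite ι] (h : ∀ i, 0 < lam i) :
    ∃ l : ℝ, 0 < l ∧ l ≤ 1 ∧ ∀ i, l ≤ lam i := by
  rcases isEmpty_or_nonempty ι with hι | hι
  · exact ⟨1, one_pos, le_rfl, fun i => hι.elim i⟩
  · obtain ⟨i, hi⟩ := Finite.exists_min lam
    exact ⟨min 1 (lam i), lt_min one_pos (h i), min_le_left _ _,
      fun j => (min_le_right _ _).trans (hi j)⟩

theorem exists_forall_le_of_lt_one [Finite ι] (h : ∀ i, lam i < 1) :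
    ∃ L : ℝ, 0 ≤ L ∧ L < 1 ∧ ∀ i, lam i ≤ L := by
  rcases isEmpty_or_nonempty ι with hι | hι
  · exact ⟨0, le_rfl, one_pos, fun i => hι.elim i⟩
  · obtain ⟨i, hi⟩ := Finite.exists_max lam
    exact ⟨max 0 (lam i), le_max_left _ _, max_lt one_pos (h i),
      fun j => (hi j).trans (le_max_right _ _)⟩

/-- Under the open set condition, boundedly many pieces of size about `r` meet a ball of
radius `r`. -/
theorem exists_card_le_of_openSetCondition [Finite ι] {X : Type*} [NormedAddCommGroup X]
    [NormedSpace ℝ X] [StrictConvexSpace ℝ X] [FiniteDimensional ℝ X] {f : ι → X → X}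
    (hpos : ∀ i, 0 < lam i) (hf : ∀ i x y, dist (f i x) (f i y) = lam i * dist x y)
    {V : Set X} (hVne : V.Nonempty) (hVo : IsOpen V) (hV : ∀ i, f i '' V ⊆ V)
    (hd : ∀ i j, i ≠ j → Disjoint (f i '' V) (f j '' V))
    {E : Set X} (hE : Bornology.IsBounded E) :
    ∃ M : ℝ, 0 < M ∧ ∀ r, 0 < r → r ≤ 1 → ∀ (u : X) (T : Finset (List ι)),
      (∀ p ∈ T, IsCut lam r p ∧ (wordMap f p '' E ∩ Metric.closedBall u r).Nonempty) →
      (T.card : ℝ) ≤ M := by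
  obtain ⟨l, hl0, hl1, hl⟩ := exists_forall_le_of_pos hpos
  obtain ⟨a, ha⟩ := hVne
  obtain ⟨ρ, hρ, hball⟩ := Metric.isOpen_iff.1 hVo a ha
  obtain ⟨R, hR, hER⟩ := hE.subset_closedBall_lt 0 a
  refine ⟨((1 + R + ρ) / (l * ρ)) ^ Module.finrank ℝ X, by positivity, fun r hr hr1 u T hT => ?_⟩
  have hsurj : ∀ i, Function.Surjective (f i) := fun i => surjective_of_dist_eq_mul (hpos i) (hf i)
  have hinj : ∀ i, Function.Injective (f i) := fun i x y hxy => by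
    have := hf i x y
    rw [hxy, dist_self] at this
    exact dist_eq_zero.1 ((mul_eq_zero.1 this.symm).resolve_left (hpos i).ne')
  have hlr : l * r ≤ 1 := mul_le_one₀ hl1 hr.le hr1
  have hsub : ∀ p ∈ T, Metric.ball (wordMap f p a) (r * (l * ρ)) ⊆ wordMap f p '' V := by
    intro p hp y hy
    obtain ⟨x, rfl⟩ := wordMap_surjective hsurj p y
    refine Set.mem_image_of_mem _ (hball ?_)
    rw [Metric.mem_ball, dist_wordMap hf] at hy
    rw [Metric.mem_ball]
    have h1 := (hT p hp).1.le_wordRatio hpos hl hr hlr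
    have h2 := mul_le_mul_of_nonneg_right h1 hρ.le
    exact lt_of_mul_lt_mul_left (hy.trans_le (by linarith)) (wordRatio_pos hpos p).le
  have key := card_le_of_pairwiseDisjoint_ball (T := T) (g := fun p => wordMap f p a)
    (ρ := r * (l * ρ)) (R := r * (1 + R + ρ)) (u := u) (by positivity) (by positivity)
    (fun p hp q hq hpq => ((hT p hp).1.disjoint_image hinj hV hd (hT q hq).1 hpq).mono
      (hsub p hp) (hsub q hq)) ?_
  · rwa [mul_div_mul_left _ _ hr.ne'] at key
  · intro p hp y hy
    obtain ⟨hcut, _, ⟨e, he, rfl⟩, hu⟩ := hT p hp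
    rw [Metric.mem_ball] at hy ⊢
    rw [Metric.mem_closedBall] at hu
    have h1 : dist (wordMap f p a) (wordMap f p e) ≤ r * R := by
      rw [dist_wordMap hf, dist_comm]
      exact mul_le_mul (hcut.wordRatio_le hpos) (hER he) dist_nonneg hr.le
    have h2 := dist_triangle4 y (wordMap f p a) (wordMap f p e) u
    have h3 : l * ρ ≤ ρ := mul_le_of_le_one_left hρ.le hl1
    have h4 := mul_le_mul_of_nonneg_left h3 hr.le
    linarith

theorem hausdorffMeasure_pos_of_openSetCondition [Fintype ι] [MeasurableSpace ι] [MeasurableSingletonClass ι]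
    {X : Type*} [NormedAddCommGroup X]
    [NormedSpace ℝ X] [StrictConvexSpace ℝ X] [FiniteDimensional ℝ X] [MeasurableSpace X]
    [BorelSpace X] {f : ι → X → X}
    (hpos : ∀ i, 0 < lam i) (hlt : ∀ i, lam i < 1)
    (hf : ∀ i x y, dist (f i x) (f i y) = lam i * dist x y)
    {V : Set X} (hVne : V.Nonempty) (hVo : IsOpen V) (hV : ∀ i, f i '' V ⊆ V)
    (hd : ∀ i j, i ≠ j → Disjoint (f i '' V) (f j '' V))
    {E : Set X} (hne : E.Nonempty) (hc : IsCompact E) (hE : ∀ i, f i '' E ⊆ E)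
    {s : ℝ} (hs : 0 ≤ s) (hsum : ∑ i, lam i ^ s = 1) : 0 < μH[s] E := by
  classical
  obtain ⟨M, hM0, hM⟩ := exists_card_le_of_openSetCondition hpos hf hVne hVo hV hd hc.isBounded
  obtain ⟨L, hL0, hL1, hL⟩ := exists_forall_le_of_lt_one hlt
  have hcont : ∀ i, Continuous (f i) := fun i =>
    (LipschitzWith.of_dist_le_mul (K := ⟨lam i, (hpos i).le⟩) fun x y => (hf i x y).le).continuous
  choose π hπ using exists_forall_mem_wordMap_image hcont hne hc hE
  have h0 : ∀ i, 0 ≤ lam i ^ s := fun i => (Real.rpow_pos_of_pos (hpos i) s).le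
  have := isProbabilityMeasure_letterMeasure h0 hsum
  set P := bernoulliMeasure fun i => lam i ^ s with hPdef
  have hP : IsProbabilityMeasure P := by
    unfold P bernoulliMeasure; infer_instance
  have hball : ∀ r, 0 < r → r ≤ 1 → ∀ (u : X) (U : Set X), U ⊆ Metric.closedBall u r →
      P (π ⁻¹' U) ≤ ENNReal.ofReal M * ENNReal.ofReal r ^ s := by
    intro r hr hr1 u U hU
    obtain ⟨N, hN⟩ := exists_pow_lt_of_lt_one hr hL1
    have hfin := finite_setOf_isCut hpos hL hL0 N r hN.le
    let T := hfin.toFinset.filter fun p => (wordMap f p '' E ∩ Metric.closedBall u r).Nonempty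
    have hT : ∀ p ∈ T, IsCut lam r p ∧ (wordMap f p '' E ∩ Metric.closedBall u r).Nonempty := by
      intro p hp
      simpa [T] using hp
    calc P (π ⁻¹' U) ≤ P (⋃ p ∈ T, cylinderSet p) := by
          refine measure_mono fun w hw => ?_
          obtain ⟨p, hp, hwp⟩ := exists_isCut_mem_cylinderSet hpos hL hL0 N r w hN.le
          have : p ∈ T := by
            simp only [T, Finset.mem_filter, Set.Finite.mem_toFinset]
            exact ⟨hp, π w, hπ w p hwp, hU hw⟩
          exact Set.mem_iUnion₂.2 ⟨p, this, hwp⟩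
      _ ≤ ∑ p ∈ T, P (cylinderSet p) := measure_biUnion_finset_le _ _
      _ ≤ ∑ _p ∈ T, ENNReal.ofReal r ^ s := by
          refine Finset.sum_le_sum fun p hp => ?_
          rw [hPdef, bernoulliMeasure_cylinderSet h0 hsum, wordRatio_rpow hpos,
            ENNReal.ofReal_rpow_of_nonneg hr.le hs]
          exact ENNReal.ofReal_le_ofReal (Real.rpow_le_rpow (wordRatio_pos hpos p).le
            ((hT p hp).1.wordRatio_le hpos) hs)
      _ = (T.card : ℝ≥0∞) * ENNReal.ofReal r ^ s := by simp
      _ ≤ _ := by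
          gcongr
          rw [← ENNReal.ofReal_natCast]
          exact ENNReal.ofReal_le_ofReal (hM r hr hr1 u T hT)
  have hC0 : ENNReal.ofReal M ≠ 0 := (ENNReal.ofReal_pos.2 hM0).ne'
  have hdiam : ∀ U : Set X, Metric.ediam U ≤ ENNReal.ofReal (1 / 2) →
      P (π ⁻¹' U) ≤ ENNReal.ofReal M * Metric.ediam U ^ s := by
    intro U hU
    rcases U.eq_empty_or_nonempty with rfl | ⟨u, hu⟩
    · simp
    have hfinite : Metric.ediam U ≠ ⊤ := (hU.trans_lt ENNReal.ofReal_lt_top).ne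
    set D := (Metric.ediam U).toReal with hD
    have hDU : Metric.ediam U = ENNReal.ofReal D := (ENNReal.ofReal_toReal hfinite).symm
    have hD2 : D ≤ 1 / 2 := ENNReal.toReal_le_of_le_ofReal (by norm_num) hU
    have hD0 : 0 ≤ D := ENNReal.toReal_nonneg
    have hcts : Continuous fun ε : ℝ => ENNReal.ofReal M * ENNReal.ofReal (D + ε) ^ s :=
      (ENNReal.continuous_const_mul ENNReal.ofReal_ne_top).comp
        ((ENNReal.continuous_rpow_const).comp (ENNReal.continuous_ofReal.comp (by fun_prop)))
    have hlim := (hcts.tendsto 0).mono_left (nhdsWithin_le_nhds (s := Set.Ioi 0))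
    rw [add_zero, ← hDU] at hlim
    refine ge_of_tendsto hlim ?_
    filter_upwards [Ioc_mem_nhdsGT (show (0 : ℝ) < 1 / 2 by norm_num)] with ε hε
    refine hball (D + ε) (by linarith [hε.1]) (by linarith [hε.2]) u U fun x hx => ?_
    rw [Metric.mem_closedBall, dist_edist]
    refine ENNReal.toReal_le_of_le_ofReal (by linarith [hε.1])
      ((Metric.edist_le_ediam_of_mem hx hu).trans ?_)
    rw [hDU]
    exact ENNReal.ofReal_le_ofReal (by linarith [hε.1])
  have hle := OuterMeasure.le_mkMetric (fun x => x ^ s)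
    ((ENNReal.ofReal M)⁻¹ • OuterMeasure.map π P.toOuterMeasure) (ENNReal.ofReal (1 / 2))
    (ENNReal.ofReal_pos.2 (by norm_num)) (fun U hU => by
      rw [smul_apply, OuterMeasure.map_apply, smul_eq_mul,
        ENNReal.inv_mul_le_iff hC0 ENNReal.ofReal_ne_top]
      exact hdiam U hU) E
  rw [OuterMeasure.coe_mkMetric, smul_apply, OuterMeasure.map_apply] at hle
  have hpre : π ⁻¹' E = Set.univ := Set.eq_univ_of_forall fun w => by
    simpa [wordMap] using hπ w [] (mem_cylinderSet_nil w)
  refine lt_of_lt_of_le ?_ hle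
  simp [hpre]

theorem limsup_coverNum_mul_lt_top [Fintype ι] [MeasurableSpace ι] [MeasurableSingletonClass ι] {d : ℕ}
    {f : ι → EuclideanSpace ℝ (Fin d) → EuclideanSpace ℝ (Fin d)}
    (hpos : ∀ i, 0 < lam i) (hlt : ∀ i, lam i < 1)
    (hf : ∀ i x y, dist (f i x) (f i y) = lam i * dist x y)
    {E : Set (EuclideanSpace ℝ (Fin d))} (hne : E.Nonempty) (hb : Bornology.IsBounded E)
    (hE : E ⊆ ⋃ i, f i '' E) {s : ℝ} (hs : 0 ≤ s) (hsum : ∑ i, lam i ^ s = 1) :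
    limsup (fun δ : ℝ => coverNum E δ * ENNReal.ofReal (δ ^ s)) (nhdsWithin 0 (Set.Ioi 0)) < ⊤ := by
  classical
  obtain ⟨l, hl0, hl1, hl⟩ := exists_forall_le_of_pos hpos
  obtain ⟨L, hL0, hL1, hL⟩ := exists_forall_le_of_lt_one hlt
  obtain ⟨e, he⟩ := hne
  obtain ⟨D, hD, hED⟩ := hb.subset_closedBall_lt 0 e
  have hlD : 0 < (l / D) ^ s := Real.rpow_pos_of_pos (by positivity) s
  refine lt_of_le_of_lt (limsup_le_of_le (a := (ENNReal.ofReal ((l / D) ^ s))⁻¹) (h := ?_))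
    (ENNReal.inv_lt_top.2 (ENNReal.ofReal_pos.2 hlD))
  filter_upwards [Ioc_mem_nhdsGT hD] with δ hδ
  set r := δ / D
  have hr : 0 < r := div_pos hδ.1 hD
  have hr1 : r ≤ 1 := (div_le_one hD).2 hδ.2
  obtain ⟨N, hN⟩ := exists_pow_lt_of_lt_one hr hL1
  have hfin := finite_setOf_isCut hpos hL hL0 N r hN.le
  set T := hfin.toFinset
  have hT : ∀ p ∈ T, IsCut lam r p := fun p hp => by simpa [T] using hp
  have hcover : coverNum E δ ≤ T.card := by
    refine (iInf₂_le (T.image fun p => wordMap f p e) fun x hx => ?_).trans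
      (by exact_mod_cast Finset.card_image_le)
    obtain ⟨p, hp, y, hy, rfl⟩ := exists_isCut_mem_image hpos hL hL0 hE N r hN.le x hx
    refine Set.mem_iUnion₂.2 ⟨wordMap f p e, Finset.mem_image_of_mem _ (by simpa [T] using hp), ?_⟩
    rw [Metric.mem_closedBall, dist_wordMap hf]
    calc wordRatio lam p * dist y e ≤ r * D :=
          mul_le_mul (hp.wordRatio_le hpos) (hED hy) dist_nonneg hr.le
      _ = δ := div_mul_cancel₀ _ hD.ne'
  have hcard : (T.card : ℝ≥0∞) * ENNReal.ofReal ((l * r) ^ s) ≤ 1 := by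
    refine le_trans ?_ (sum_wordRatio_rpow_le_one hpos hsum hT)
    rw [← nsmul_eq_mul]
    exact Finset.card_nsmul_le_sum _ _ _ fun p hp => ENNReal.ofReal_le_ofReal
      (Real.rpow_le_rpow (by positivity)
        ((hT p hp).le_wordRatio hpos hl hr (mul_le_one₀ hl1 hr.le hr1)) hs)
  rw [ENNReal.le_inv_iff_mul_le, mul_assoc,
    ← ENNReal.ofReal_mul (Real.rpow_nonneg hδ.1.le s), ← Real.mul_rpow hδ.1.le (by positivity),
    show δ * (l / D) = l * r by simp only [r]; ring]
  exact (mul_le_mul_left hcover _).trans hcard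

end Attractor

end IteratedFunctionSystem

/-- Hutchinson's theorem: under the open set condition, the attractor of a system of
contracting similarities has positive `s`-dimensional Hausdorff measure, where
`∑ λᵢ^s = 1`; consequently `dim_H E = dim_M E = s`. -/
theorem stmt10 {d k : ℕ} (hk : 0 < k)
    (f : Fin k → EuclideanSpace ℝ (Fin d) → EuclideanSpace ℝ (Fin d))
    (lam : Fin k → ℝ) (hlam : ∀ i, 0 < lam i ∧ lam i < 1)
    (hf : ∀ i x y, dist (f i x) (f i y) = lam i * dist x y)
    (V : Set (EuclideanSpace ℝ (Fin d))) (hVne : V.Nonempty) (hVo : IsOpen V)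
    (hVsub : (⋃ i, f i '' V) ⊆ V)
    (hVdisj : ∀ i j, i ≠ j → f i '' V ∩ f j '' V = ∅)
    (E : Set (EuclideanSpace ℝ (Fin d)))
    (hE : E.Nonempty ∧ IsCompact E ∧ E = ⋃ i, f i '' E)
    (s : ℝ) (hs : 0 ≤ s) (hsum : ∑ i, lam i ^ s = 1) :
    0 < μH[s] E ∧ dimH E = ENNReal.ofReal s ∧ uMinkDim E = s := by
  obtain ⟨hne, hc, hEq⟩ := hE
  have hpos : ∀ i, 0 < lam i := fun i => (hlam i).1
  have hlt : ∀ i, lam i < 1 := fun i => (hlam i).2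
  have hH : 0 < μH[s] E :=
    IteratedFunctionSystem.hausdorffMeasure_pos_of_openSetCondition hpos hlt hf hVne hVo
      (fun i => (Set.subset_iUnion _ i).trans hVsub)
      (fun i j hij => Set.disjoint_iff_inter_eq_empty.2 (hVdisj i j hij)) hne hc
      (fun i => (Set.subset_iUnion (fun i => f i '' E) i).trans hEq.symm.subset) hs hsum
  have hM := IteratedFunctionSystem.limsup_coverNum_mul_lt_top hpos hlt hf hne hc.isBounded
    hEq.subset hs hsum
  have hle : ∀ t : ℝ, 0 ≤ t → limsup (fun δ : ℝ => coverNum E δ * ENNReal.ofReal (δ ^ t))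
      (nhdsWithin 0 (Set.Ioi 0)) < ⊤ → dimH E ≤ ENNReal.ofReal t := fun t ht h =>
    dimH_le_of_hausdorffMeasure_ne_top (d := t.toNNReal) (by
      rw [Real.coe_toNNReal t ht]
      exact (IteratedFunctionSystem.hausdorffMeasure_lt_top_of_limsup_coverNum_lt_top ht h).ne)
  have hge : ENNReal.ofReal s ≤ dimH E :=
    le_dimH_of_hausdorffMeasure_ne_zero (d := s.toNNReal) (by
      rw [Real.coe_toNNReal s hs]
      exact hH.ne')
  refine ⟨hH, (hle s hs hM).antisymm hge, ?_⟩
  have hleast : IsLeast {t : ℝ | 0 ≤ t ∧ limsup (fun δ : ℝ => coverNum E δ *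
      ENNReal.ofReal (δ ^ t)) (nhdsWithin 0 (Set.Ioi 0)) < ⊤} s :=
    ⟨⟨hs, hM⟩, fun t ht => (ENNReal.ofReal_le_ofReal_iff ht.1).1 (hge.trans (hle t ht.1 ht.2))⟩
  exact hleast.csInf_eq
end

section
/- Let E be the attractor of an IFS of contracting similarities on ℝ^d with ratios λ_i and similarity dimension s (∑ λ_i^s = 1). If ℋ^s(E) > 0, then the IFS satisfies the open set condition. -/
open ENNReal MeasureTheory

open scoped NNReal

section SelfSimilar

variable {X ι : Type*}

/-- The composition of the maps `f i` along a word, leftmost letter outermost. -/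
def wordMap (f : ι → X → X) (w : List ι) (x : X) : X :=
  w.foldr f x

/-- The product of the ratios `lam i` along a word. -/
def wordRatio (lam : ι → ℝ≥0) (w : List ι) : ℝ≥0 :=
  (w.map lam).prod

variable {f : ι → X → X} {lam : ι → ℝ≥0} {K : Set X}

@[simp]
theorem wordMap_nil (x : X) : wordMap f [] x = x :=
  rfl

@[simp]
theorem wordMap_cons (i : ι) (w : List ι) (x : X) : wordMap f (i :: w) x = f i (wordMap f w x) :=
  rfl

@[simp]
theorem wordMap_append (u v : List ι) (x : X) :
    wordMap f (u ++ v) x = wordMap f u (wordMap f v x) := by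
  simp [wordMap]

@[simp]
theorem wordRatio_nil : wordRatio lam [] = 1 := by
  simp [wordRatio]

@[simp]
theorem wordRatio_cons (i : ι) (w : List ι) :
    wordRatio lam (i :: w) = lam i * wordRatio lam w := by
  simp [wordRatio]

@[simp]
theorem wordRatio_append (u v : List ι) :
    wordRatio lam (u ++ v) = wordRatio lam u * wordRatio lam v := by
  simp [wordRatio]

theorem wordRatio_pos (hlam : ∀ i, 0 < lam i) (w : List ι) : 0 < wordRatio lam w := by
  induction w with
  | nil => simp
  | cons i w ih => simpa using ⟨hlam i, ih⟩

theorem wordRatio_le_one (hlam : ∀ i, lam i ≤ 1) (w : List ι) : wordRatio lam w ≤ 1 := by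
  induction w with
  | nil => simp
  | cons i w ih => simpa using mul_le_one' (hlam i) ih

theorem wordRatio_lt_one (hlam : ∀ i, lam i < 1) {w : List ι} (hw : w ≠ []) :
    wordRatio lam w < 1 := by
  cases w with
  | nil => exact absurd rfl hw
  | cons i w =>
    rw [wordRatio_cons]
    exact mul_lt_one_of_lt_of_le (hlam i) (wordRatio_le_one (fun i ↦ (hlam i).le) w)

theorem wordRatio_le_of_prefix (hlam : ∀ i, lam i ≤ 1) {u v : List ι} (h : u <+: v) :
    wordRatio lam v ≤ wordRatio lam u := by
  obtain ⟨t, rfl⟩ := h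
  rw [wordRatio_append]
  exact mul_le_of_le_one_right' (wordRatio_le_one hlam t)

/-- Every word of ratio at most `t < 1` has a prefix at which the ratio first drops to `t`. -/
theorem exists_prefix_wordRatio_le {t : ℝ≥0} (ht : t < 1) (w : List ι)
    (hw : wordRatio lam w ≤ t) :
    ∃ m, m <+: w ∧ m ≠ [] ∧ wordRatio lam m ≤ t ∧ t < wordRatio lam m.dropLast := by
  induction w using List.reverseRecOn with
  | nil => exact absurd hw (by simpa using ht)
  | append_singleton w i ih =>
    by_cases h : wordRatio lam w ≤ t
    · obtain ⟨m, hm, h'⟩ := ih h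
      exact ⟨m, hm.trans (List.prefix_append _ _), h'⟩
    · exact ⟨w ++ [i], List.prefix_rfl, by simp, hw, by simpa using h⟩

theorem wordMap_mem (hK : ⋃ i, f i '' K = K) (w : List ι) {x : X} (hx : x ∈ K) :
    wordMap f w x ∈ K := by
  induction w with
  | nil => exact hx
  | cons i w ih =>
    rw [← hK]
    exact Set.mem_iUnion.2 ⟨i, Set.mem_image_of_mem _ ih⟩

theorem wordMap_image_subset (hK : ⋃ i, f i '' K = K) (w : List ι) : wordMap f w '' K ⊆ K :=
  Set.image_subset_iff.2 fun _ ↦ wordMap_mem hK w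

variable [MetricSpace X]

theorem edist_wordMap (hf : ∀ i x y, edist (f i x) (f i y) = lam i * edist x y) (w : List ι)
    (x y : X) : edist (wordMap f w x) (wordMap f w y) = wordRatio lam w * edist x y := by
  induction w with
  | nil => simp
  | cons i w ih => simp [hf, ih, mul_assoc]

theorem injective_of_edist_eq {g : X → X} {c : ℝ≥0} (hc : 0 < c)
    (hg : ∀ x y, edist (g x) (g y) = c * edist x y) : Function.Injective g := fun x y h ↦ by
  have := hg x y
  rw [h, edist_self, eq_comm, mul_eq_zero] at this
  simpa [hc.ne'] using this

theorem ediam_image_of_edist_eq_le {g : X → X} {c : ℝ≥0}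
    (hg : ∀ x y, edist (g x) (g y) = c * edist x y) (A : Set X) :
    Metric.ediam (g '' A) ≤ c * Metric.ediam A :=
  LipschitzWith.ediam_image_le (fun x y ↦ (hg x y).le) A

/-- The words `m` at which the ratio first drops to that of `κ` and whose piece of `K` comes close
to the piece of `κ`, relative to the ratio of `κ`. -/
def neighborWords (f : ι → X → X) (lam : ι → ℝ≥0) (K : Set X) (κ : List ι) : Set (List ι) :=
  {m | m ≠ [] ∧ wordRatio lam m ≤ wordRatio lam κ ∧ wordRatio lam κ < wordRatio lam m.dropLast ∧
    ∃ x ∈ K, ∃ y ∈ K, edist (wordMap f m x) (wordMap f κ y) < 2 * wordRatio lam κ}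

theorem append_mem_neighborWords (hlam : ∀ i, 0 < lam i)
    (hf : ∀ i x y, edist (f i x) (f i y) = lam i * edist x y) (u : List ι) {κ m : List ι}
    (hm : m ∈ neighborWords f lam K κ) : u ++ m ∈ neighborWords f lam K (u ++ κ) := by
  obtain ⟨h0, h1, h2, x, hx, y, hy, h3⟩ := hm
  have hu := wordRatio_pos hlam u
  refine ⟨by simp [h0], ?_, ?_, x, hx, y, hy, ?_⟩
  · simpa using by gcongr
  · rw [List.dropLast_append_of_ne_nil h0, wordRatio_append, wordRatio_append]
    gcongr
  · rw [wordMap_append, wordMap_append, edist_wordMap hf, wordRatio_append, ENNReal.coe_mul,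
      mul_left_comm]
    exact ENNReal.mul_lt_mul_right (by simpa using hu.ne') (by simp) h3

theorem not_prefix_of_mem_neighborWords (hlam : ∀ i, lam i ≤ 1) {κ m n : List ι}
    (hm : m ∈ neighborWords f lam K κ) (hn : n ∈ neighborWords f lam K κ) (hmn : m ≠ n) :
    ¬ m <+: n := by
  intro h
  obtain ⟨t, rfl⟩ := h
  have ht : t ≠ [] := by rintro rfl; simp at hmn
  have h := hn.2.2.1
  rw [List.dropLast_append_of_ne_nil ht] at h
  exact absurd (h.trans_le (wordRatio_le_of_prefix hlam (List.prefix_append _ _))) hm.2.1.not_gt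

theorem ediam_biUnion_neighborWords_le
    (hf : ∀ i x y, edist (f i x) (f i y) = lam i * edist x y) (κ : List ι) :
    Metric.ediam (⋃ m ∈ neighborWords f lam K κ, wordMap f m '' K) ≤
      (4 * (Metric.ediam K + 1)) * wordRatio lam κ := by
  rcases K.eq_empty_or_nonempty with rfl | ⟨p, hp⟩
  · simp
  have hp : ∀ m ∈ neighborWords f lam K κ, ∀ x ∈ K,
      edist (wordMap f m x) (wordMap f κ p) ≤ 2 * (Metric.ediam K + 1) * wordRatio lam κ := by
    rintro m ⟨-, hm, -, y, hy, z, hz, h⟩ x hx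
    calc edist (wordMap f m x) (wordMap f κ p)
        ≤ edist (wordMap f m x) (wordMap f m y) + edist (wordMap f m y) (wordMap f κ z)
            + edist (wordMap f κ z) (wordMap f κ p) := edist_triangle4 _ _ _ _
      _ ≤ wordRatio lam κ * Metric.ediam K + 2 * wordRatio lam κ
            + wordRatio lam κ * Metric.ediam K := by
          rw [edist_wordMap hf, edist_wordMap hf]
          gcongr
          · exact Metric.edist_le_ediam_of_mem hx hy
          · exact Metric.edist_le_ediam_of_mem hz hp
      _ = _ := by ring
  refine Metric.ediam_le ?_
  simp only [Set.mem_iUnion, Set.mem_image]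
  rintro _ ⟨m, hm, x, hx, rfl⟩ _ ⟨n, hn, y, hy, rfl⟩
  refine (edist_triangle_right _ _ (wordMap f κ p)).trans
    ((add_le_add (hp m hm x hx) (hp n hn y hy)).trans_eq ?_)
  ring

/-- The open set condition holds once the numbers of neighbours of pieces are bounded. -/
theorem exists_open_of_neighborWords_card_le [Nonempty ι] (hlam : ∀ i, 0 < lam i ∧ lam i < 1)
    (hf : ∀ i x y, edist (f i x) (f i y) = lam i * edist x y) (hne : K.Nonempty)
    (hK : ⋃ i, f i '' K = K) {N : ℕ}
    (hN : ∀ κ, ∀ T : Finset (List ι), ↑T ⊆ neighborWords f lam K κ → T.card ≤ N) :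
    ∃ V : Set X, V.Nonempty ∧ IsOpen V ∧ (⋃ i, f i '' V) ⊆ V ∧
      ∀ i j, i ≠ j → f i '' V ∩ f j '' V = ∅ := by
  have hpos := fun i ↦ (hlam i).1
  have hfin : ∀ κ, (neighborWords f lam K κ).Finite := fun κ ↦ by
    by_contra h
    obtain ⟨T, hT, hc⟩ := Set.Infinite.exists_subset_card_eq h (N + 1)
    have := hN κ T hT
    omega
  have hcard : ∀ κ, (neighborWords f lam K κ).ncard ≤ N := fun κ ↦ by
    rw [Set.ncard_eq_toFinset_card _ (hfin κ)]
    exact hN κ _ (by simp)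
  obtain ⟨κ, hκ, hmax⟩ : ∃ κ : List ι, κ ≠ [] ∧ ∀ u : List ι, u ≠ [] →
      (neighborWords f lam K u).ncard ≤ (neighborWords f lam K κ).ncard := by
    let S : Set ℕ := (fun κ ↦ (neighborWords f lam K κ).ncard) '' {κ | κ ≠ []}
    have hb : BddAbove S := ⟨N, by rintro _ ⟨κ, -, rfl⟩; exact hcard κ⟩
    have hS : S.Nonempty := ⟨_, [Classical.arbitrary ι], by simp, rfl⟩
    obtain ⟨κ, hκ, h⟩ := Nat.sSup_mem hS hb
    exact ⟨κ, hκ, fun u hu ↦ (le_csSup hb ⟨u, hu, rfl⟩).trans_eq h.symm⟩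
  have heq : ∀ u, (u ++ ·) '' neighborWords f lam K κ = neighborWords f lam K (u ++ κ) := by
    intro u
    refine Set.eq_of_subset_of_ncard_le ?_ ?_ (hfin _)
    · rintro _ ⟨m, hm, rfl⟩
      exact append_mem_neighborWords hpos hf u hm
    · rw [Set.ncard_image_of_injective _ (List.append_right_injective u)]
      exact hmax _ (by simp [hκ])
  -- Distinct first letters keep the pieces `u ++ κ` apart.
  have key : ∀ (i j : ι) (u v : List ι), i ≠ j →
      wordRatio lam (j :: v) ≤ wordRatio lam (i :: u ++ κ) → ∀ x ∈ K, ∀ y ∈ K,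
      2 * (wordRatio lam (i :: u ++ κ) : ℝ≥0∞) ≤
        edist (wordMap f (j :: v) x) (wordMap f (i :: u ++ κ) y) := by
    intro i j u v hij hr x hx y hy
    by_contra! hlt
    obtain ⟨m, ⟨t, ht⟩, hm0, hm1, hm2⟩ := exists_prefix_wordRatio_le
      (wordRatio_lt_one (fun i ↦ (hlam i).2) (by simp)) (j :: v) hr
    have hm : m ∈ neighborWords f lam K (i :: u ++ κ) := by
      refine ⟨hm0, hm1, hm2, wordMap f t x, wordMap_mem hK t hx, y, hy, ?_⟩
      rwa [← wordMap_append, ht]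
    rw [← heq] at hm
    obtain ⟨n, -, rfl⟩ := hm
    simp at ht
    exact hij ht.1
  have far : ∀ (i j : ι) (u v : List ι), i ≠ j → ∀ x ∈ K, ∀ y ∈ K,
      (wordRatio lam (i :: u ++ κ) : ℝ≥0∞) + wordRatio lam (j :: v ++ κ) ≤
        edist (wordMap f (i :: u ++ κ) x) (wordMap f (j :: v ++ κ) y) := by
    intro i j u v hij x hx y hy
    rcases le_total (wordRatio lam (j :: v ++ κ)) (wordRatio lam (i :: u ++ κ)) with h | h
    · refine le_trans ?_ ((key i j u (v ++ κ) hij h y hy x hx).trans_eq (edist_comm _ _))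
      rw [two_mul]
      gcongr
    · refine le_trans ?_ (key j i v (u ++ κ) hij.symm h x hx y hy)
      rw [two_mul]
      gcongr
  let V : Set X := {x | ∃ u : List ι, ∃ y ∈ K,
    edist x (wordMap f (u ++ κ) y) < wordRatio lam (u ++ κ)}
  have hV : ∀ i, ∀ x ∈ V, ∃ u, ∃ y ∈ K,
      edist (f i x) (wordMap f (i :: u ++ κ) y) < wordRatio lam (i :: u ++ κ) := by
    rintro i x ⟨u, y, hy, h⟩
    refine ⟨u, y, hy, ?_⟩
    rw [List.cons_append, wordMap_cons, hf, wordRatio_cons, ENNReal.coe_mul]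
    exact ENNReal.mul_lt_mul_right (by simpa using (hpos i).ne') (by simp) h
  refine ⟨V, ?_, ?_, ?_, ?_⟩
  · obtain ⟨y, hy⟩ := hne
    refine ⟨wordMap f ([] ++ κ) y, [], y, hy, ?_⟩
    simpa using wordRatio_pos hpos κ
  · have : V = ⋃ u : List ι, ⋃ y ∈ K,
        {x | edist x (wordMap f (u ++ κ) y) < wordRatio lam (u ++ κ)} := by
      ext x; simp [V]
    rw [this]
    exact isOpen_iUnion fun u ↦ isOpen_biUnion fun y _ ↦
      isOpen_lt (by fun_prop) continuous_const
  · refine Set.iUnion_subset fun i ↦ Set.image_subset_iff.2 fun x hx ↦ ?_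
    obtain ⟨u, y, hy, h⟩ := hV i x hx
    exact ⟨i :: u, y, hy, h⟩
  · intro i j hij
    refine Set.eq_empty_iff_forall_notMem.2 ?_
    rintro _ ⟨⟨x, hx, rfl⟩, x', hx', he⟩
    obtain ⟨u, y, hy, h⟩ := hV i x hx
    obtain ⟨v, y', hy', h'⟩ := hV j x' hx'
    rw [he] at h'
    refine absurd (far i j u v hij y hy y' hy') (not_le.2 ?_)
    refine (edist_triangle_left _ _ (f i x)).trans_lt ?_
    exact ENNReal.add_lt_add h h'

variable [MeasurableSpace X] [BorelSpace X] {s : ℝ}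

theorem hausdorffMeasure_image_of_edist_eq {g : X → X} {c : ℝ≥0} (hc : 0 < c)
    (hg : ∀ x y, edist (g x) (g y) = c * edist x y) (hs : 0 ≤ s) (A : Set X) :
    μH[s] (g '' A) = (c : ℝ≥0∞) ^ s * μH[s] A := by
  have hc0 : (c : ℝ≥0∞) ≠ 0 := by simpa using hc.ne'
  refine le_antisymm (LipschitzWith.hausdorffMeasure_image_le (fun x y ↦ (hg x y).le) hs A) ?_
  have hg' : AntilipschitzWith c⁻¹ g := fun x y ↦ by
    rw [hg, ENNReal.coe_inv hc.ne', ← mul_assoc, ENNReal.inv_mul_cancel hc0 (by simp), one_mul]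
  calc (c : ℝ≥0∞) ^ s * μH[s] A
      ≤ (c : ℝ≥0∞) ^ s * (((c⁻¹ : ℝ≥0) : ℝ≥0∞) ^ s * μH[s] (g '' A)) := by
        gcongr
        exact hg'.le_hausdorffMeasure_image hs A
    _ = μH[s] (g '' A) := by
        rw [← mul_assoc, ← ENNReal.mul_rpow_of_nonneg _ _ hs, ENNReal.coe_inv hc.ne',
          ENNReal.mul_inv_cancel hc0 (by simp), ENNReal.one_rpow, one_mul]

theorem hausdorffMeasure_wordMap_image (hlam : ∀ i, 0 < lam i)
    (hf : ∀ i x y, edist (f i x) (f i y) = lam i * edist x y) (hs : 0 ≤ s) (w : List ι)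
    (A : Set X) : μH[s] (wordMap f w '' A) = (wordRatio lam w : ℝ≥0∞) ^ s * μH[s] A :=
  hausdorffMeasure_image_of_edist_eq (wordRatio_pos hlam w) (edist_wordMap hf w) hs A

theorem pre_le_hausdorffMeasure {r : ℝ≥0∞} (hr : 0 < r) (A : Set X) :
    OuterMeasure.mkMetric'.pre (fun B : Set X ↦ Metric.ediam B ^ s) r A ≤ μH[s] A := by
  rw [Measure.hausdorffMeasure, ← OuterMeasure.coe_mkMetric, OuterMeasure.mkMetric,
    OuterMeasure.mkMetric']
  have := le_iSup₂_of_le (f := fun (r : ℝ≥0∞) (_ : r > 0) ↦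
    OuterMeasure.mkMetric'.pre (fun B : Set X ↦ Metric.ediam B ^ s) r) r hr le_rfl
  exact this A

variable [Fintype ι]

theorem pre_wordMap_image_le (hlam : ∀ i, 0 < lam i)
    (hf : ∀ i x y, edist (f i x) (f i y) = lam i * edist x y) (hK : ⋃ i, f i '' K = K)
    (hs : 0 ≤ s) (hsum : ∑ i, (lam i : ℝ≥0∞) ^ s = 1) {c : ℝ≥0} (hc : ∀ i, lam i ≤ c)
    {A : Set X} (hA : A ⊆ K) {r : ℝ≥0∞} (hr : 0 < r) (n : ℕ) (u : List ι)
    (hu : wordRatio lam u * (c : ℝ≥0∞) ^ n * Metric.ediam K ≤ r) :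
    OuterMeasure.mkMetric'.pre (fun B : Set X ↦ Metric.ediam B ^ s) r (wordMap f u '' K) ≤
      (wordRatio lam u : ℝ≥0∞) ^ s * (Metric.ediam A ^ s + μH[s] (K \ A)) := by
  induction n generalizing u with
  | zero =>
    have hd := ediam_image_of_edist_eq_le (edist_wordMap hf u) A
    conv_lhs => rw [← Set.union_sdiff_cancel hA, Set.image_union]
    refine (measure_union_le _ _).trans ?_
    rw [mul_add]
    gcongr
    · refine (OuterMeasure.mkMetric'.pre_le ?_).trans ?_
      · refine hd.trans (le_trans ?_ hu)
        rw [pow_zero, mul_one]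
        gcongr
      · rw [← ENNReal.mul_rpow_of_nonneg _ _ hs]
        gcongr
    · refine (pre_le_hausdorffMeasure hr _).trans_eq ?_
      exact hausdorffMeasure_wordMap_image hlam hf hs u _
  | succ n ih =>
    have h : wordMap f u '' K = ⋃ i, wordMap f (u ++ [i]) '' K := by
      conv_lhs => rw [← hK, Set.image_iUnion]
      simp_rw [Set.image_image]
      refine Set.iUnion_congr fun i ↦ Set.image_congr fun x _ ↦ ?_
      rw [wordMap_append, wordMap_cons, wordMap_nil]
    rw [h]
    refine (measure_iUnion_fintype_le _ _).trans ?_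
    calc _ ≤ ∑ i, (wordRatio lam (u ++ [i]) : ℝ≥0∞) ^ s *
            (Metric.ediam A ^ s + μH[s] (K \ A)) := by
          refine Finset.sum_le_sum fun i _ ↦ ih _ (le_trans ?_ hu)
          simp only [wordRatio_append, wordRatio_cons, wordRatio_nil, mul_one, ENNReal.coe_mul]
          rw [pow_succ', ← mul_assoc]
          gcongr
          exact hc i
      _ = _ := by
          rw [← Finset.sum_mul]
          congr 1
          simp only [wordRatio_append, wordRatio_cons, wordRatio_nil, mul_one, ENNReal.coe_mul,
            ENNReal.mul_rpow_of_nonneg _ _ hs]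
          rw [← Finset.mul_sum, hsum, mul_one]

theorem hausdorffMeasure_le_ediam_rpow_add (hlam : ∀ i, 0 < lam i ∧ lam i < 1)
    (hf : ∀ i x y, edist (f i x) (f i y) = lam i * edist x y) (hK : ⋃ i, f i '' K = K)
    (hd : Metric.ediam K ≠ ∞) (hs : 0 ≤ s) (hsum : ∑ i, (lam i : ℝ≥0∞) ^ s = 1)
    {A : Set X} (hA : A ⊆ K) : μH[s] K ≤ Metric.ediam A ^ s + μH[s] (K \ A) := by
  obtain ⟨c, hc1, hc⟩ : ∃ c : ℝ≥0, c < 1 ∧ ∀ i, lam i ≤ c :=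
    ⟨Finset.univ.sup lam, (Finset.sup_lt_iff (by simp)).2 fun i _ ↦ (hlam i).2,
      fun i ↦ Finset.le_sup (Finset.mem_univ i)⟩
  have hlim : Filter.Tendsto (fun n : ℕ ↦ (c : ℝ≥0∞) ^ n * Metric.ediam K) Filter.atTop
      (nhds 0) := by
    simpa using ENNReal.Tendsto.mul_const
      (ENNReal.tendsto_pow_atTop_nhds_zero_of_lt_one (by simpa using hc1)) (Or.inr hd)
  rw [Measure.hausdorffMeasure, ← OuterMeasure.coe_mkMetric, OuterMeasure.mkMetric,
    OuterMeasure.mkMetric']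
  simp only [OuterMeasure.iSup_apply]
  refine iSup₂_le fun r hr ↦ ?_
  obtain ⟨n, hn⟩ := (hlim.eventually (gt_mem_nhds hr)).exists
  have := pre_wordMap_image_le (fun i ↦ (hlam i).1) hf hK hs hsum hc hA hr n []
    (by simpa using hn.le)
  have h1 : wordMap f [] '' K = K := by
    ext; simp
  simpa [h1, Measure.hausdorffMeasure, ← OuterMeasure.coe_mkMetric, OuterMeasure.mkMetric,
    OuterMeasure.mkMetric'] using this

theorem hausdorffMeasure_ne_top_of_selfSimilar (hlam : ∀ i, 0 < lam i ∧ lam i < 1)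
    (hf : ∀ i x y, edist (f i x) (f i y) = lam i * edist x y) (hK : ⋃ i, f i '' K = K)
    (hd : Metric.ediam K ≠ ∞) (hs : 0 ≤ s) (hsum : ∑ i, (lam i : ℝ≥0∞) ^ s = 1) :
    μH[s] K ≠ ∞ := by
  have h := hausdorffMeasure_le_ediam_rpow_add hlam hf hK hd hs hsum subset_rfl
  rw [Set.sdiff_self, measure_empty, add_zero] at h
  exact ne_top_of_le_ne_top (ENNReal.rpow_ne_top_of_nonneg hs hd) h

/-- At the similarity dimension, the Hausdorff measure of a part of a self-similar set is bounded
by the corresponding power of its diameter. -/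
theorem hausdorffMeasure_le_ediam_rpow (hlam : ∀ i, 0 < lam i ∧ lam i < 1)
    (hf : ∀ i x y, edist (f i x) (f i y) = lam i * edist x y) (hK : ⋃ i, f i '' K = K)
    (hd : Metric.ediam K ≠ ∞) (hs : 0 ≤ s) (hsum : ∑ i, (lam i : ℝ≥0∞) ^ s = 1)
    {A : Set X} (hA : A ⊆ K) (hm : MeasurableSet A) : μH[s] A ≤ Metric.ediam A ^ s := by
  have h := hausdorffMeasure_le_ediam_rpow_add hlam hf hK hd hs hsum hA
  have ht := hausdorffMeasure_ne_top_of_selfSimilar hlam hf hK hd hs hsum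
  rw [← measure_inter_add_sdiff K hm, Set.inter_eq_right.2 hA] at h
  exact (ENNReal.add_le_add_iff_right (measure_ne_top_of_subset Set.sdiff_subset ht)).1 h

theorem aedisjoint_image_of_selfSimilar (hlam : ∀ i, 0 < lam i ∧ lam i < 1)
    (hf : ∀ i x y, edist (f i x) (f i y) = lam i * edist x y) (hK : ⋃ i, f i '' K = K)
    (hc : IsCompact K) (hs : 0 ≤ s) (hsum : ∑ i, (lam i : ℝ≥0∞) ^ s = 1) {i j : ι}
    (hij : i ≠ j) : AEDisjoint (μH[s] : Measure X) (f i '' K) (f j '' K) := by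
  classical
  have ht := hausdorffMeasure_ne_top_of_selfSimilar hlam hf hK hc.isBounded.ediam_ne_top hs hsum
  have hcont : ∀ i, Continuous (f i) := fun i ↦
    LipschitzWith.continuous (K := lam i) fun x y ↦ (hf i x y).le
  have hmeas : ∀ l, μH[s] (f l '' K) = (lam l : ℝ≥0∞) ^ s * μH[s] K := fun l ↦
    hausdorffMeasure_image_of_edist_eq (hlam l).1 (hf l) hs K
  have hj : j ∈ Finset.univ.erase i := by simp [hij.symm]
  let R : Finset ι := (Finset.univ.erase i).erase j
  have hsplit : ∀ φ : ι → ℝ≥0∞, ∑ l, φ l = φ i + φ j + ∑ l ∈ R, φ l := fun φ ↦ by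
    rw [← Finset.add_sum_erase _ _ (Finset.mem_univ i), ← Finset.add_sum_erase _ _ hj, add_assoc]
  have hcover : K ⊆ (f i '' K ∪ f j '' K) ∪ ⋃ l ∈ R, f l '' K := by
    conv_lhs => rw [← hK]
    refine Set.iUnion_subset fun l x hx ↦ ?_
    by_cases hi : l = i
    · exact Or.inl (Or.inl (hi ▸ hx))
    by_cases hj : l = j
    · exact Or.inl (Or.inr (hj ▸ hx))
    · exact Or.inr (Set.mem_biUnion (by simp [R, hi, hj]) hx)
  have h1 : μH[s] K + μH[s] (f i '' K ∩ f j '' K) ≤ μH[s] K := by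
    calc μH[s] K + μH[s] (f i '' K ∩ f j '' K)
        ≤ (μH[s] (f i '' K ∪ f j '' K) + ∑ l ∈ R, μH[s] (f l '' K))
            + μH[s] (f i '' K ∩ f j '' K) := by
          gcongr
          refine (measure_mono hcover).trans ((measure_union_le _ _).trans ?_)
          gcongr
          exact measure_biUnion_finset_le _ _
      _ = ∑ l, μH[s] (f l '' K) := by
          rw [add_right_comm, measure_union_add_inter _ (hc.image (hcont j)).measurableSet, hsplit]
      _ = μH[s] K := by
          simp_rw [hmeas]
          rw [← Finset.sum_mul, hsum, one_mul]
  rw [AEDisjoint]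
  by_contra h0
  exact absurd h1 (ENNReal.lt_add_right ht h0).not_ge

theorem aedisjoint_wordMap_image (hlam : ∀ i, 0 < lam i ∧ lam i < 1)
    (hf : ∀ i x y, edist (f i x) (f i y) = lam i * edist x y) (hK : ⋃ i, f i '' K = K)
    (hc : IsCompact K) (hs : 0 ≤ s) (hsum : ∑ i, (lam i : ℝ≥0∞) ^ s = 1) {u v : List ι}
    (huv : ¬ u <+: v) (hvu : ¬ v <+: u) :
    AEDisjoint (μH[s] : Measure X) (wordMap f u '' K) (wordMap f v '' K) := by
  induction u generalizing v with
  | nil => exact absurd List.nil_prefix huv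
  | cons i u ih =>
    cases v with
    | nil => exact absurd List.nil_prefix hvu
    | cons j v =>
      have himg : ∀ l w, wordMap f (l :: w) '' K = f l '' (wordMap f w '' K) := fun l w ↦
        (Set.image_image (f l) (wordMap f w) K).symm
      rw [himg, himg]
      by_cases hij : i = j
      · subst hij
        simp only [List.prefix_cons_inj] at huv hvu
        rw [AEDisjoint, ← Set.image_inter (injective_of_edist_eq (hlam i).1 (hf i)),
          hausdorffMeasure_image_of_edist_eq (hlam i).1 (hf i) hs, ih huv hvu, mul_zero]
      · exact (aedisjoint_image_of_selfSimilar hlam hf hK hc hs hsum hij).mono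
          (Set.image_mono (wordMap_image_subset hK u)) (Set.image_mono (wordMap_image_subset hK v))

theorem exists_neighborWords_card_le (hlam : ∀ i, 0 < lam i ∧ lam i < 1)
    (hf : ∀ i x y, edist (f i x) (f i y) = lam i * edist x y) (hK : ⋃ i, f i '' K = K)
    (hc : IsCompact K) (hs : 0 ≤ s) (hsum : ∑ i, (lam i : ℝ≥0∞) ^ s = 1)
    (hpos : 0 < μH[s] K) :
    ∃ N : ℕ, ∀ κ, ∀ T : Finset (List ι), ↑T ⊆ neighborWords f lam K κ → T.card ≤ N := by
  have hd := hc.isBounded.ediam_ne_top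
  obtain ⟨c, hc0, hcl⟩ : ∃ c : ℝ≥0, 0 < c ∧ ∀ i, c ≤ lam i := by
    cases isEmpty_or_nonempty ι
    · exact ⟨1, one_pos, fun i ↦ isEmptyElim i⟩
    · obtain ⟨i, hi⟩ := Finite.exists_min lam
      exact ⟨lam i, (hlam i).1, hi⟩
  set M : ℝ≥0∞ := (4 * (Metric.ediam K + 1)) ^ s with hM
  have hMt : M ≠ ∞ := ENNReal.rpow_ne_top_of_nonneg hs
    (ENNReal.mul_ne_top (by simp) (by simpa using hd))
  have hc0' : (c : ℝ≥0∞) ^ s * μH[s] K ≠ 0 :=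
    mul_ne_zero (ENNReal.rpow_pos (by simpa using hc0) (by simp)).ne' hpos.ne'
  obtain ⟨N, hN⟩ := ENNReal.exists_nat_gt (ENNReal.div_ne_top hMt hc0')
  refine ⟨N, fun κ T hT ↦ ?_⟩
  have hρ := wordRatio_pos (fun i ↦ (hlam i).1) κ
  have hρ0 : (wordRatio lam κ : ℝ≥0∞) ^ s ≠ 0 :=
    (ENNReal.rpow_pos (by simpa using hρ) (by simp)).ne'
  have hρt : (wordRatio lam κ : ℝ≥0∞) ^ s ≠ ∞ := ENNReal.rpow_ne_top_of_nonneg hs (by simp)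
  have hcont : ∀ w, Continuous (wordMap f w) := fun w ↦
    LipschitzWith.continuous (K := wordRatio lam w) fun x y ↦ (edist_wordMap hf w x y).le
  have hms : ∀ m, MeasurableSet (wordMap f m '' K) := fun m ↦ (hc.image (hcont m)).measurableSet
  have hlow : ∀ m ∈ T, (c : ℝ≥0∞) ^ s * μH[s] K * (wordRatio lam κ : ℝ≥0∞) ^ s ≤
      μH[s] (wordMap f m '' K) := fun m hm ↦ by
    obtain ⟨h0, -, h2, -⟩ := hT hm
    rw [hausdorffMeasure_wordMap_image (fun i ↦ (hlam i).1) hf hs, mul_right_comm,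
      ← ENNReal.mul_rpow_of_nonneg _ _ hs]
    gcongr
    rw [← ENNReal.coe_mul, ENNReal.coe_le_coe]
    conv_rhs => rw [← List.dropLast_append_getLast h0]
    rw [wordRatio_append, mul_comm]
    gcongr
    simpa using hcl _
  have hbound : (T.card : ℝ≥0∞) * ((c : ℝ≥0∞) ^ s * μH[s] K) * (wordRatio lam κ : ℝ≥0∞) ^ s ≤
      M * (wordRatio lam κ : ℝ≥0∞) ^ s := by
    calc (T.card : ℝ≥0∞) * ((c : ℝ≥0∞) ^ s * μH[s] K) * (wordRatio lam κ : ℝ≥0∞) ^ s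
        ≤ ∑ m ∈ T, μH[s] (wordMap f m '' K) := by
          rw [mul_assoc, ← nsmul_eq_mul]
          exact Finset.card_nsmul_le_sum _ _ _ hlow
      _ = μH[s] (⋃ m ∈ T, wordMap f m '' K) := by
          refine (measure_biUnion_finset₀ (fun m hm n hn hmn ↦ ?_)
            fun m _ ↦ (hms m).nullMeasurableSet).symm
          have hle := fun i ↦ (hlam i).2.le
          exact aedisjoint_wordMap_image hlam hf hK hc hs hsum
            (not_prefix_of_mem_neighborWords hle (hT hm) (hT hn) hmn)
            (not_prefix_of_mem_neighborWords hle (hT hn) (hT hm) hmn.symm)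
      _ ≤ Metric.ediam (⋃ m ∈ T, wordMap f m '' K) ^ s :=
          hausdorffMeasure_le_ediam_rpow hlam hf hK hd hs hsum
            (Set.iUnion₂_subset fun m _ ↦ wordMap_image_subset hK m)
            (T.measurableSet_biUnion fun m _ ↦ hms m)
      _ ≤ M * (wordRatio lam κ : ℝ≥0∞) ^ s := by
          rw [hM, ← ENNReal.mul_rpow_of_nonneg _ _ hs]
          gcongr
          exact (Metric.ediam_mono (Set.biUnion_subset_biUnion_left hT)).trans
            (ediam_biUnion_neighborWords_le hf κ)
  have h := (ENNReal.mul_le_mul_iff_left hρ0 hρt).1 hbound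
  have h' : (T.card : ℝ≥0∞) ≤ M / ((c : ℝ≥0∞) ^ s * μH[s] K) :=
    (ENNReal.le_div_iff_mul_le (Or.inl hc0') (Or.inr hMt)).2 h
  exact_mod_cast (h'.trans_lt hN).le

end SelfSimilar

/-- Schief's theorem: if the attractor of a system of contracting similarities has
positive `s`-dimensional Hausdorff measure (`∑ λᵢ^s = 1`), then the open set
condition holds. -/
theorem stmt11 {d k : ℕ} (hk : 0 < k)
    (f : Fin k → EuclideanSpace ℝ (Fin d) → EuclideanSpace ℝ (Fin d))
    (lam : Fin k → ℝ) (hlam : ∀ i, 0 < lam i ∧ lam i < 1)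
    (hf : ∀ i x y, dist (f i x) (f i y) = lam i * dist x y)
    (E : Set (EuclideanSpace ℝ (Fin d)))
    (hE : E.Nonempty ∧ IsCompact E ∧ E = ⋃ i, f i '' E)
    (s : ℝ) (hs : 0 ≤ s) (hsum : ∑ i, lam i ^ s = 1)
    (hpos : 0 < μH[s] E) :
    ∃ V : Set (EuclideanSpace ℝ (Fin d)), V.Nonempty ∧ IsOpen V ∧
      (⋃ i, f i '' V) ⊆ V ∧ ∀ i j, i ≠ j → f i '' V ∩ f j '' V = ∅ := by
  have : Nonempty (Fin k) := ⟨⟨0, hk⟩⟩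
  obtain ⟨hne, hc, hK⟩ := hE
  lift lam to Fin k → ℝ≥0 using fun i ↦ (hlam i).1.le
  have hlam' : ∀ i, 0 < lam i ∧ lam i < 1 := fun i ↦ by exact_mod_cast hlam i
  have hf' : ∀ i x y, edist (f i x) (f i y) = lam i * edist x y := fun i x y ↦ by
    rw [edist_nndist, edist_nndist, ← ENNReal.coe_mul, ENNReal.coe_inj]
    exact NNReal.eq (hf i x y)
  have hsum' : ∑ i, (lam i : ℝ≥0∞) ^ s = 1 := by
    simp_rw [← ENNReal.coe_rpow_of_nonneg _ hs]
    norm_cast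
    rw [← NNReal.coe_inj]
    push_cast
    exact hsum
  obtain ⟨N, hN⟩ := exists_neighborWords_card_le hlam' hf' hK.symm hc hs hsum' hpos
  exact exists_open_of_neighborWords_card_le hlam' hf' hne hK.symm hN
end
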